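/- Let F : ℝ → ℝ be a strictly increasing continuous bijection from ℝ onto the open interval (0,1) (an order isomorphism ℝ ≃o (0,1)), let ν be a Borel probability measure on ℝ whose cumulative distribution function G(t) := ν((-∞, t]) is continuous, let n ∈ ℕ, let s_1, …, s_n : ℝ → ℝ be order isomorphisms of ℝ, and let s ∈ ℝ be such that s_i^{-1}(s) ∈ (0,1) for every i. Define the statistic S(x) := max_{i=1,…,n} s_i(F(x_(i))) for x : Fin n → ℝ. Then ν^n({ x : S(x) > s }) = 1 - μ_n({ u : ∀ i, u_(i) ≤ G(F^{-1}(s_i^{-1}(s))) }), where ν^n is the n-fold product of ν. That is, the power of the test based on S against the alternative ν equals one minus a one-sided non-crossing probability of an i.i.d. U[0,1] sample with bounds B_i = G(F^{-1}(s_i^{-1}(s))). -/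

import Mathlib

open MeasureTheory

/-- The order statistics of the sample `x`: `orderStat x i` is the `(i+1)`-st
smallest entry of `x` (0-based indexing). -/
noncomputable def orderStat {n : ℕ} (x : Fin n → ℝ) : Fin n → ℝ :=
  x ∘ Tuple.sort x

/-- The law of an i.i.d. sample of `n` uniform `U[0,1]` random variables. -/
noncomputable def unifn (n : ℕ) : Measure (Fin n → ℝ) :=
  Measure.pi fun _ => volume.restrict (Set.Icc (0:ℝ) 1)

open ProbabilityTheory Filter Topology

/-- The `(i+1)`-st smallest entry of `x` is at most `b` iff more than `i` entries of `x` are. -/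
lemma orderStat_le_iff {n : ℕ} (x : Fin n → ℝ) (i : Fin n) (b : ℝ) :
    orderStat x i ≤ b ↔ (i : ℕ) < ({j | x j ≤ b} : Finset (Fin n)).card := by
  rw [← Tuple.lt_card_le_iff_apply_le_of_monotone (f := orderStat x) (j := i)
    (Tuple.monotone_sort x)]
  have h : ({j | orderStat x j ≤ b} : Finset (Fin n)).card =
      ({j | x j ≤ b} : Finset (Fin n)).card :=
    Finset.card_equiv (Tuple.sort x) fun j => by
      simp only [Finset.mem_filter_univ]
      exact Iff.rfl
  rw [h]

lemma measurableSet_orderStat_le {n : ℕ} (b : Fin n → ℝ) :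
    MeasurableSet {x : Fin n → ℝ | ∀ i, orderStat x i ≤ b i} := by
  have h : {x : Fin n → ℝ | ∀ i, orderStat x i ≤ b i} =
      ⋂ i : Fin n, {x : Fin n → ℝ | ((i : ℕ) : ℝ) < ∑ j, (Set.Iic (b i)).indicator 1 (x j)} := by
    ext x
    simp only [Set.mem_ofPred_eq, Set.mem_iInter, orderStat_le_iff,
      Set.indicator_apply, Set.mem_Iic, Pi.one_apply, Finset.sum_boole, Nat.cast_lt]
  rw [h]
  refine MeasurableSet.iInter fun i => measurableSet_lt measurable_const ?_
  exact Finset.measurable_sum _ fun j _ =>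
    (measurable_one.indicator measurableSet_Iic).comp (measurable_pi_apply j)

lemma volume_restrict_Icc_Iic (a : ℝ) :
    volume.restrict (Set.Icc (0 : ℝ) 1) (Set.Iic a) = ENNReal.ofReal (min 1 a) := by
  have h : Set.Iic a ∩ Set.Icc (0 : ℝ) 1 = Set.Icc 0 (min 1 a) := by
    ext x
    simp only [Set.mem_inter_iff, Set.mem_Iic, Set.mem_Icc, le_min_iff]
    tauto
  rw [Measure.restrict_apply measurableSet_Iic, h, Real.volume_Icc, sub_zero]

lemma measure_cdf_le_of_lt_one (ν : Measure ℝ) [IsProbabilityMeasure ν]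
    (hG : Continuous (cdf ν)) {a : ℝ} (ha : a < 1) :
    ν {x | cdf ν x ≤ a} = ENNReal.ofReal a := by
  rcases Set.eq_empty_or_nonempty {x | cdf ν x ≤ a} with h | hne
  · have h0 : a ≤ 0 := by
      refine ge_of_tendsto (tendsto_cdf_atBot ν) (Eventually.of_forall fun x => ?_)
      exact (not_le.mp fun hx => (h ▸ hx : x ∈ (∅ : Set ℝ))).le
    rw [h, measure_empty, ENNReal.ofReal_of_nonpos h0]
  · obtain ⟨y, hy⟩ := ((tendsto_cdf_atTop ν).eventually (lt_mem_nhds ha)).exists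
    have hbdd : BddAbove {x | cdf ν x ≤ a} :=
      ⟨y, fun x hx => le_of_not_gt fun hxy => (hy.trans_le (monotone_cdf ν hxy.le)).not_ge hx⟩
    have hmem : cdf ν (sSup {x | cdf ν x ≤ a}) ≤ a :=
      (isClosed_le hG continuous_const).csSup_mem hne hbdd
    set t := sSup {x | cdf ν x ≤ a}
    have hS : {x | cdf ν x ≤ a} = Set.Iic t :=
      Set.Subset.antisymm (fun x hx => le_csSup hbdd hx)
        fun x hx => (monotone_cdf ν hx).trans hmem
    have ht : a ≤ cdf ν t := by
      refine ge_of_tendsto (hG.continuousWithinAt (s := Set.Ioi t) (x := t)) ?_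
      filter_upwards [self_mem_nhdsWithin] with x hx
      exact (not_le.mp fun h => (Set.mem_Ioi.mp hx).not_ge (hS.subset h)).le
    rw [hS, ← ofReal_cdf, le_antisymm hmem ht]

/-- The probability integral transform: a continuous cumulative distribution function pushes its
law forward to the uniform law on `[0, 1]`. -/
theorem map_cdf_eq_uniform (ν : Measure ℝ) [IsProbabilityMeasure ν] (hG : Continuous (cdf ν)) :
    ν.map (cdf ν) = volume.restrict (Set.Icc (0 : ℝ) 1) := by
  have := Measure.isProbabilityMeasure_map (μ := ν) hG.aemeasurable
  refine Measure.ext_of_Iic _ _ fun a => ?_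
  rw [Measure.map_apply hG.measurable measurableSet_Iic, volume_restrict_Icc_Iic]
  rcases lt_or_ge a 1 with ha | ha
  · rw [min_eq_right ha.le]
    exact measure_cdf_le_of_lt_one ν hG ha
  · rw [min_eq_left ha, ENNReal.ofReal_one]
    have h : cdf ν ⁻¹' Set.Iic a = Set.univ :=
      Set.eq_univ_of_forall fun x => (cdf_le_one ν x).trans ha
    rw [h, measure_univ]

lemma ae_cdf_le_cdf_iff (ν : Measure ℝ) [IsProbabilityMeasure ν] (hG : Continuous (cdf ν))
    (t : ℝ) : ∀ᵐ x ∂ν, cdf ν x ≤ cdf ν t ↔ x ≤ t := by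
  have hle : ν (cdf ν ⁻¹' Set.Iic (cdf ν t)) ≤ ν (Set.Iic t) := by
    rw [← Measure.map_apply hG.measurable measurableSet_Iic, map_cdf_eq_uniform ν hG,
      volume_restrict_Icc_Iic, min_eq_right (cdf_le_one ν t), ofReal_cdf]
  have h := ae_eq_of_subset_of_measure_ge
    (fun x (hx : x ∈ Set.Iic t) => monotone_cdf ν hx) hle
    measurableSet_Iic.nullMeasurableSet (measure_ne_top _ _)
  filter_upwards [h] with x hx
  exact (iff_of_eq hx).symm

/-- One-sided non-crossing probabilities of an i.i.d. sample with continuous cumulative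
distribution function agree with those of a uniform sample. -/
theorem measure_orderStat_le (ν : Measure ℝ) [IsProbabilityMeasure ν] (hG : Continuous (cdf ν))
    {n : ℕ} (t : Fin n → ℝ) :
    (Measure.pi fun _ : Fin n => ν) {x | ∀ i, orderStat x i ≤ t i} =
      unifn n {u | ∀ i, orderStat u i ≤ cdf ν (t i)} := by
  have := Measure.isProbabilityMeasure_map (μ := ν) hG.aemeasurable
  rw [unifn, ← map_cdf_eq_uniform ν hG, ← Measure.pi_map_pi fun _ => hG.aemeasurable,
    Measure.map_apply (by fun_prop) (measurableSet_orderStat_le _)]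
  have hae : ∀ᵐ x ∂(Measure.pi fun _ : Fin n => ν), ∀ i j,
      cdf ν (x j) ≤ cdf ν (t i) ↔ x j ≤ t i :=
    ae_all_iff.mpr fun i => ae_all_iff.mpr fun j =>
      (Measure.tendsto_eval_ae_ae (μ := fun _ : Fin n => ν) (i := j)).eventually
        (ae_cdf_le_cdf_iff ν hG (t i))
  refine measure_congr ?_
  filter_upwards [hae] with x hx
  refine propext (forall_congr' fun i => ?_)
  simp only [orderStat_le_iff, hx]

/-- Let `F : ℝ ≃o (0,1)` be an order isomorphism (a strictly
increasing continuous bijection from `ℝ` onto `(0,1)`), let `ν` be a Borel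
probability measure on `ℝ` with continuous CDF `G t = ν (-∞, t]`, let
`s i : ℝ ≃o ℝ` and `sv : ℝ` with `(s i)⁻¹ sv ∈ (0,1)` for all `i`, and let
`S x := max_i s i (F (x_(i)))`. Then
`νⁿ {x : S x > sv} = 1 - P(∀ i, U_(i) ≤ G (F⁻¹ ((s i)⁻¹ sv)))` for an i.i.d.
`U[0,1]` sample. -/
theorem stmt_17 (F : ℝ ≃o Set.Ioo (0:ℝ) 1)
    (ν : Measure ℝ) [IsProbabilityMeasure ν]
    (hG : Continuous fun t => (ν (Set.Iic t)).toReal)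
    (n : ℕ) (hn : 0 < n) (s : Fin n → (ℝ ≃o ℝ)) (sv : ℝ)
    (hs : ∀ i : Fin n, (s i).symm sv ∈ Set.Ioo (0:ℝ) 1) :
    (Measure.pi fun _ : Fin n => ν)
      {x | sv < Finset.univ.sup'
          (Finset.univ_nonempty_iff.mpr (Fin.pos_iff_nonempty.mp hn))
          (fun i => s i ((F (orderStat x i) : ℝ)))} =
      1 - unifn n {u | ∀ i : Fin n,
        orderStat u i ≤ (ν (Set.Iic ((F.symm ⟨(s i).symm sv, hs i⟩ : ℝ)))).toReal} := by
  have hcdf (t : ℝ) : (ν (Set.Iic t)).toReal = cdf ν t := (cdf_eq_real ν t).symm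
  simp only [hcdf] at hG ⊢
  rw [← measure_orderStat_le ν hG, ← prob_compl_eq_one_sub (measurableSet_orderStat_le _)]
  congr 1
  ext x
  simp only [Set.mem_ofPred_eq, Set.mem_compl_iff, Finset.lt_sup'_iff, Finset.mem_univ, true_and,
    not_forall, not_le]
  refine exists_congr fun i => ?_
  rw [← OrderIso.symm_apply_lt, OrderIso.symm_apply_lt F]
  exact Iff.rfl
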